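/- arXiv:2507.00941 — 3 statements merged into one kernel-verified Lean document; each statement's English description precedes it below -/
import Mathlib

section
/- For every integer k ≥ 2, there exists a finite connected simple graph G such that cop'_1(G) ≤ k, cop_1(G) = 2k, and moreover the classical cop number satisfies cop(G) = 2k; consequently cop_1(G) ≥ 2·cop'_1(G), and cop_l(G) - cop'_l(G) ≥ k for every positive integer l. -/
open Classical

/-- A cop at `c` sees the vertex `v` when `v` is within distance `l` of `c`. -/
def inSight {V : Type} (G : SimpleGraph V) (l : ℕ) (c v : V) : Prop :=
  G.Reachable c v ∧ G.dist c v ≤ l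

/-- A legal robber trajectory: at each turn the robber stays put or moves
to an adjacent vertex. -/
def LegalRobber {V : Type} (G : SimpleGraph V) (r : ℕ → V) : Prop :=
  ∀ t, r (t + 1) = r t ∨ G.Adj (r t) (r (t + 1))

/-- A legal sequence of cop positions: at each turn every cop stays put or
moves to an adjacent vertex. -/
def LegalCopPath {V : Type} (G : SimpleGraph V) {k : ℕ} (P : ℕ → Fin k → V) : Prop :=
  ∀ t i, P (t + 1) i = P t i ∨ G.Adj (P t i) (P (t + 1) i)

/-- The observation made by `l`-visibility cops at positions `P` when the robber
is at `rv`: they see the robber exactly when he is within distance `l` of some cop. -/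
noncomputable def visObs {V : Type} (G : SimpleGraph V) (l : ℕ) {k : ℕ}
    (P : Fin k → V) (rv : V) : Option V :=
  if ∃ i, inSight G l (P i) rv then some rv else none

/-- The play of the `l`-visibility game: given initial cop positions `init`, a cop
strategy `σ` (a function of the history of observations only), and a robber
trajectory `r`, this returns the cop positions after `t` cop moves together with the
history of observations made so far. -/
noncomputable def visPlay {V : Type} (G : SimpleGraph V) (l : ℕ) {k : ℕ}
    (init : Fin k → V) (σ : List (Option V) → Fin k → V) (r : ℕ → V) :
    ℕ → (Fin k → V) × List (Option V)
  | 0 => (init, [])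
  | t + 1 =>
    let prev := visPlay G l init σ r t
    let h := prev.2 ++ [visObs G l prev.1 (r t)]
    (σ h, h)

/-- Cop positions after `t` cop moves in the `l`-visibility game. -/
noncomputable def visPos {V : Type} (G : SimpleGraph V) (l : ℕ) {k : ℕ}
    (init : Fin k → V) (σ : List (Option V) → Fin k → V) (r : ℕ → V) (t : ℕ) :
    Fin k → V :=
  (visPlay G l init σ r t).1

/-- `k` cops with visibility `l` can guarantee capturing the robber on `G`:
there are initial positions and a strategy (depending only on the cops' observations)
whose moves are always legal and such that, against every legal robber trajectory,
some cop eventually occupies the robber's vertex. -/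
def VisCopsCapture {V : Type} (G : SimpleGraph V) (l k : ℕ) : Prop :=
  ∃ (init : Fin k → V) (σ : List (Option V) → Fin k → V),
    ∀ r : ℕ → V, LegalRobber G r →
      LegalCopPath G (visPos G l init σ r) ∧
      ∃ t i, visPos G l init σ r t i = r t ∨ visPos G l init σ r (t + 1) i = r t

/-- `k` cops with visibility `l` can guarantee seeing the robber on `G`. -/
def VisCopsSee {V : Type} (G : SimpleGraph V) (l k : ℕ) : Prop :=
  ∃ (init : Fin k → V) (σ : List (Option V) → Fin k → V),
    ∀ r : ℕ → V, LegalRobber G r →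
      LegalCopPath G (visPos G l init σ r) ∧
      ∃ t i, inSight G l (visPos G l init σ r t i) (r t) ∨
        inSight G l (visPos G l init σ r (t + 1) i) (r t)

/-- The `l`-visibility capture number `cop_l(G)`. -/
noncomputable def visCaptureNum {V : Type} (G : SimpleGraph V) (l : ℕ) : ℕ :=
  sInf {k | VisCopsCapture G l k}

/-- The `l`-visibility seeing number `cop'_l(G)`. -/
noncomputable def visSeeNum {V : Type} (G : SimpleGraph V) (l : ℕ) : ℕ :=
  sInf {k | VisCopsSee G l k}

/-- Cop positions in the classical (full-information) game: the strategy `σ` may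
depend on the whole history of robber positions. -/
def fullPos {V : Type} {k : ℕ} (init : Fin k → V) (σ : List V → Fin k → V)
    (r : ℕ → V) : ℕ → Fin k → V
  | 0 => init
  | t + 1 => σ (List.ofFn fun j : Fin (t + 1) => r j.1)

/-- `k` cops with unrestricted visibility can guarantee capturing the robber on `G`. -/
def CopsCatch {V : Type} (G : SimpleGraph V) (k : ℕ) : Prop :=
  ∃ (init : Fin k → V) (σ : List V → Fin k → V),
    ∀ r : ℕ → V, LegalRobber G r →
      LegalCopPath G (fullPos init σ r) ∧
      ∃ t i, fullPos init σ r t i = r t ∨ fullPos init σ r (t + 1) i = r t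

/-- The classical cop number `cop(G)`. -/
noncomputable def copNum {V : Type} (G : SimpleGraph V) : ℕ :=
  sInf {k | CopsCatch G k}


theorem visPlay_congr {V : Type} (G : SimpleGraph V) (l : ℕ) {k : ℕ} (init : Fin k → V)
    (σ : List (Option V) → Fin k → V) {r r' : ℕ → V} (t : ℕ) (h : ∀ j < t, r j = r' j) :
    visPlay G l init σ r t = visPlay G l init σ r' t := by
  induction t with
  | zero => rfl
  | succ t ih =>
    simp only [visPlay]
    rw [ih fun j hj => h j (by omega), h t (by omega)]

/-- Unrestricted visibility is at least as good for the cops as visibility `l`. -/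
theorem VisCopsCapture.copsCatch {V : Type} {G : SimpleGraph V} {l k : ℕ}
    (h : VisCopsCapture G l k) : CopsCatch G k := by
  obtain ⟨init, σ, h⟩ := h
  rcases isEmpty_or_nonempty V with hV | ⟨⟨v₀⟩⟩
  · exact ⟨init, fun _ => init, fun r => (hV.false (r 0)).elim⟩
  refine ⟨init, fun L => visPos G l init σ (fun j => L.getD j v₀) L.length, fun r hr => ?_⟩
  have key : fullPos init (fun L => visPos G l init σ (fun j => L.getD j v₀) L.length) r =
      visPos G l init σ r := by
    funext t
    cases t with
    | zero => rfl
    | succ t =>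
      simp only [fullPos, visPos, List.length_ofFn]
      rw [visPlay_congr G l init σ (t + 1)]
      intro j hj
      rw [List.getD_eq_getElem _ _ (by simpa using hj), List.getElem_ofFn]
  rw [key]
  exact h r hr

/-- A robber confined to `A` escapes `m` cops for ever if every vertex of `A` has, against every
placement of the cops off that vertex, a neighbour in `A` out of reach of all cops. -/
theorem not_copsCatch_of_escape {V : Type} {G : SimpleGraph V} {m : ℕ} (A : Set V)
    (hstart : ∀ P : Fin m → V, ∃ v ∈ A, ∀ i, P i ≠ v)
    (hstep : ∀ P : Fin m → V, ∀ v ∈ A, (∀ i, P i ≠ v) →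
      ∃ w ∈ A, G.Adj v w ∧ ∀ i, P i ≠ w ∧ ¬ G.Adj (P i) w) :
    ¬ CopsCatch G m := by
  rintro ⟨init, σ, h⟩
  obtain ⟨v, hvA, hv⟩ := hstart init
  obtain ⟨v₀, hv₀A, -, hv₀⟩ := hstep init v hvA hv
  let next : (Fin m → V) → V → V := fun P x =>
    if hx : ∃ w ∈ A, G.Adj x w ∧ ∀ i, P i ≠ w ∧ ¬ G.Adj (P i) w then hx.choose else x
  have next_spec : ∀ P, ∀ x ∈ A, (∀ i, P i ≠ x) →
      next P x ∈ A ∧ ∀ i, P i ≠ next P x ∧ ¬ G.Adj (P i) (next P x) := by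
    intro P x hxA hx
    have hw := hstep P x hxA hx
    simp only [next, dif_pos hw]
    exact ⟨hw.choose_spec.1, hw.choose_spec.2.2⟩
  have next_legal : ∀ P x, next P x = x ∨ G.Adj x (next P x) := by
    intro P x
    by_cases hw : ∃ w ∈ A, G.Adj x w ∧ ∀ i, P i ≠ w ∧ ¬ G.Adj (P i) w
    · simp only [next, dif_pos hw]
      exact Or.inr hw.choose_spec.2.1
    · simp only [next, dif_neg hw, true_or]
  let st : ℕ → V × List V := fun t =>
    Nat.rec (v₀, [v₀]) (fun _ s => (next (σ s.2) s.1, s.2 ++ [next (σ s.2) s.1])) t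
  let r : ℕ → V := fun t => (st t).1
  have hist : ∀ t, (st t).2 = List.ofFn fun j : Fin (t + 1) => r j.1 := by
    intro t
    induction t with
    | zero => rfl
    | succ t ih =>
      rw [List.ofFn_succ', List.concat_eq_append]
      change (st t).2 ++ [r (t + 1)] = _
      rw [ih]
      rfl
  have r_succ : ∀ t, r (t + 1) = next (fullPos init σ r (t + 1)) (r t) := by
    intro t
    change next (σ (st t).2) (r t) = _
    rw [hist]
    rfl
  have hr : LegalRobber G r := fun t => by
    rw [r_succ]
    exact next_legal _ _
  obtain ⟨hleg, t, i, hcatch⟩ := h r hr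
  have unoccupied : ∀ t, (∀ i, fullPos init σ r t i ≠ r t ∧ ¬ G.Adj (fullPos init σ r t i) (r t)) →
      ∀ i, fullPos init σ r (t + 1) i ≠ r t := by
    intro t ht i hi
    rcases hleg t i with h' | h'
    · exact (ht i).1 (h' ▸ hi)
    · exact (ht i).2 (hi ▸ h')
  have safe : ∀ t, r t ∈ A ∧
      ∀ i, fullPos init σ r t i ≠ r t ∧ ¬ G.Adj (fullPos init σ r t i) (r t) := by
    intro t
    induction t with
    | zero => exact ⟨hv₀A, hv₀⟩
    | succ t ih =>
      rw [r_succ]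
      exact next_spec _ _ ih.1 (unoccupied t ih.2)
  rcases hcatch with hc | hc
  · exact ((safe t).2 i).1 hc
  · exact unoccupied t (safe t).2 i hc

theorem inSight_of_adj {V : Type} {G : SimpleGraph V} {l : ℕ} (hl : 0 < l) {c v : V}
    (h : G.Adj c v) : inSight G l c v :=
  ⟨h.reachable, by rw [SimpleGraph.dist_eq_one_iff_adj.2 h]; exact hl⟩

theorem inSight_self {V : Type} (G : SimpleGraph V) (l : ℕ) (c : V) : inSight G l c c :=
  ⟨SimpleGraph.Reachable.refl c, by simp⟩

theorem visPlay_head? {V : Type} (G : SimpleGraph V) (l : ℕ) {k : ℕ} (init : Fin k → V)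
    (σ : List (Option V) → Fin k → V) (r : ℕ → V) (t : ℕ) :
    (visPlay G l init σ r (t + 1)).2.head? = some (visObs G l init (r 0)) := by
  induction t with
  | zero => rfl
  | succ t ih =>
    rw [visPlay]
    simp [List.head?_append, ih]

/-- Cops standing on a dominating set capture the robber at once, whatever their visibility. -/
theorem visCopsCapture_of_dominating {V : Type} {G : SimpleGraph V} {l m : ℕ} (hl : 0 < l)
    (D : Fin m → V) (hD : ∀ v, ∃ i, D i = v ∨ G.Adj (D i) v) : VisCopsCapture G l m := by
  let react : Option (Option V) → Fin m → V := fun o i =>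
    match o with
    | some (some v) => if G.Adj (D i) v then v else D i
    | _ => D i
  refine ⟨D, fun h => react h.head?, fun r _ => ?_⟩
  have hobs : visObs G l D (r 0) = some (r 0) := by
    obtain ⟨i, hi⟩ := hD (r 0)
    refine if_pos ⟨i, ?_⟩
    rcases hi with hi | hi
    · rw [hi]
      exact inSight_self G l _
    · exact inSight_of_adj hl hi
  have hpos : ∀ t i, visPos G l D (fun h => react h.head?) r (t + 1) i =
      if G.Adj (D i) (r 0) then r 0 else D i := by
    intro t i
    change react (visPlay G l D (fun h => react h.head?) r (t + 1)).2.head? i = _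
    rw [visPlay_head?, hobs]
  refine ⟨fun t i => ?_, 0, ?_⟩
  · rw [hpos]
    cases t with
    | zero =>
      change _ = D i ∨ G.Adj (D i) _
      split_ifs with h
      · exact Or.inr h
      · exact Or.inl rfl
    | succ t => exact Or.inl (hpos t i).symm
  · obtain ⟨i, hi⟩ := hD (r 0)
    refine ⟨i, hi.imp id fun hi => ?_⟩
    rw [hpos, if_pos hi]

/-- If the cops can step from `D` to `D'` and the two placements together dominate the graph,
they see the robber. -/
theorem visCopsSee_of_step {V : Type} {G : SimpleGraph V} {l m : ℕ} (hl : 0 < l)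
    (D D' : Fin m → V) (hDD' : ∀ i, D' i = D i ∨ G.Adj (D i) (D' i))
    (hdom : ∀ v, ∃ i, (D i = v ∨ G.Adj (D i) v) ∨ (D' i = v ∨ G.Adj (D' i) v)) :
    VisCopsSee G l m := by
  refine ⟨D, fun _ => D', fun r _ => ⟨fun t i => ?_, 0, ?_⟩⟩
  · cases t with
    | zero => exact hDD' i
    | succ t => exact Or.inl rfl
  · have sight : ∀ c v, c = v ∨ G.Adj c v → inSight G l c v := by
      rintro c v (rfl | h)
      · exact inSight_self G l _
      · exact inSight_of_adj hl h
    obtain ⟨i, hi⟩ := hdom (r 0)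
    exact ⟨i, hi.imp (sight _ _) (sight _ _)⟩

/-- The bipartite graph on `Fin n × F × Bool` joining `(a, b, false)` and `(c, d, true)` when
`b + d = e a * e c`, together with a clique of hubs `Fin n`, the hub `a` being joined to every
`(a, b, ε)`. -/
def hubGraph {F : Type} [Field F] {n : ℕ} (e : Fin n → F) :
    SimpleGraph (Fin n ⊕ Fin n × F × Bool) where
  Adj
    | .inl a, .inl c => a ≠ c
    | .inl a, .inr y => a = y.1
    | .inr x, .inl c => x.1 = c
    | .inr x, .inr y => x.2.2 ≠ y.2.2 ∧ x.2.1 + y.2.1 = e x.1 * e y.1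
  symm := ⟨by
    rintro (a | x) (c | y) h
    · exact Ne.symm h
    · exact Eq.symm h
    · exact Eq.symm h
    · exact ⟨h.1.symm, by rw [add_comm, h.2, mul_comm]⟩⟩
  loopless := ⟨by
    rintro (a | x) h
    · exact h rfl
    · exact h.1 rfl⟩

section hubGraph

variable {F : Type} [Field F] {n : ℕ} (e : Fin n → F)

theorem hubGraph_adj_hub {a c : Fin n} (h : a ≠ c) : (hubGraph e).Adj (.inl a) (.inl c) := h

theorem hubGraph_adj_inr (x : Fin n × F × Bool) : (hubGraph e).Adj (.inl x.1) (.inr x) := rfl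

theorem hubGraph_connected (hn : 0 < n) : (hubGraph e).Connected := by
  rw [SimpleGraph.connected_iff_exists_forall_reachable]
  have hub : ∀ c, (hubGraph e).Reachable (.inl ⟨0, hn⟩) (.inl c) := by
    intro c
    by_cases h : ⟨0, hn⟩ = c
    · rw [h]
    · exact (hubGraph_adj_hub e h).reachable
  refine ⟨.inl ⟨0, hn⟩, ?_⟩
  rintro (c | x)
  · exact hub c
  · exact (hub x.1).trans (hubGraph_adj_inr e x).reachable

theorem hubGraph_not_copsCatch (he : Function.Injective e) {m : ℕ} (hm : m < n) :
    ¬ CopsCatch (hubGraph e) m := by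
  have pigeon : ∀ f : Fin n → Fin m, ∃ c c', c ≠ c' ∧ f c = f c' := fun f =>
    Fintype.exists_ne_map_eq_of_card_lt f (by simpa using hm)
  refine not_copsCatch_of_escape (Set.range Sum.inr) (fun P => ?_) ?_
  · by_contra! hP
    choose f hf using fun c : Fin n => hP (.inr (c, 0, true)) ⟨_, rfl⟩
    obtain ⟨c, c', hne, hff⟩ := pigeon f
    have := (hf c).symm.trans ((congrArg P hff).trans (hf c'))
    simp only [Sum.inr.injEq, Prod.mk.injEq, and_true] at this
    exact hne this
  · rintro P _ ⟨⟨a, b, ε⟩, rfl⟩ hP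
    by_contra! hcov
    choose f hf using fun c : Fin n => hcov (.inr (c, e a * e c - b, !ε)) ⟨_, rfl⟩
      ⟨by simp, by simp⟩
    obtain ⟨c, c', hne, hff⟩ := pigeon f
    have h₁ := hf c
    have h₂ := hf c'
    have hu := hP (f c)
    rw [← hff] at h₂
    generalize P (f c) = u at h₁ h₂ hu
    rcases u with d | ⟨a', b', ε'⟩
    · have hd : d = c := h₁ (by simp)
      have hd' : d = c' := h₂ (by simp)
      exact hne (hd.symm.trans hd')
    · by_cases hc : (Sum.inr (a', b', ε') : Fin n ⊕ Fin n × F × Bool) =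
          .inr (c, e a * e c - b, !ε)
      · obtain ⟨rfl, rfl, rfl⟩ := by simpa using hc
        exact (h₂ (by simpa using fun h => (hne h).elim)).1 rfl
      by_cases hc' : (Sum.inr (a', b', ε') : Fin n ⊕ Fin n × F × Bool) =
          .inr (c', e a * e c' - b, !ε)
      · obtain ⟨rfl, rfl, rfl⟩ := by simpa using hc'
        exact (h₁ hc).1 rfl
      obtain ⟨hε, hb⟩ := h₁ hc
      obtain ⟨-, hb'⟩ := h₂ hc'
      dsimp only at hε hb hb'
      have hmul : (e a - e a') * (e c - e c') = 0 := by linear_combination hb - hb'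
      have ha : a = a' := by
        rcases mul_eq_zero.1 hmul with h | h
        · exact he (sub_eq_zero.1 h)
        · exact (hne (he (sub_eq_zero.1 h))).elim
      subst ha
      have hbb : b' = b := by linear_combination hb
      have hεε : ε' = ε := by simpa using hε
      exact hu (by rw [hbb, hεε])

theorem hubGraph_visCopsCapture {l : ℕ} (hl : 0 < l) : VisCopsCapture (hubGraph e) l n := by
  refine visCopsCapture_of_dominating hl Sum.inl ?_
  rintro (a | x)
  · exact ⟨a, Or.inl rfl⟩
  · exact ⟨x.1, Or.inr (hubGraph_adj_inr e x)⟩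

theorem hubGraph_visCopsSee {k : ℕ} (e : Fin (2 * k) → F) {l : ℕ} (hl : 0 < l) :
    VisCopsSee (hubGraph e) l k := by
  let lo : Fin k → Fin (2 * k) := fun i => ⟨i, by omega⟩
  let hi : Fin k → Fin (2 * k) := fun i => ⟨k + i, by omega⟩
  have cover : ∀ a, ∃ i, lo i = a ∨ hi i = a := by
    intro a
    by_cases h : a.1 < k
    · exact ⟨⟨a, h⟩, Or.inl rfl⟩
    · exact ⟨⟨a - k, by omega⟩, Or.inr (Fin.ext (by simp only [hi]; omega))⟩
  refine visCopsSee_of_step hl (fun i => .inl (lo i)) (fun i => .inl (hi i))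
    (fun i => Or.inr (hubGraph_adj_hub e (Fin.ne_of_val_ne (by simp only [lo, hi]; omega)))) ?_
  rintro (a | x)
  · obtain ⟨i, h⟩ := cover a
    exact ⟨i, h.imp (fun h => Or.inl (congrArg _ h)) fun h => Or.inl (congrArg _ h)⟩
  · obtain ⟨i, h⟩ := cover x.1
    exact ⟨i, h.imp (fun h => Or.inr h) fun h => Or.inr h⟩

theorem hubGraph_copNum (he : Function.Injective e) : copNum (hubGraph e) = n :=
  le_antisymm (Nat.sInf_le (hubGraph_visCopsCapture e one_pos).copsCatch)
    (le_csInf ⟨n, (hubGraph_visCopsCapture e one_pos).copsCatch⟩ fun _ h =>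
      not_lt.1 fun hlt => hubGraph_not_copsCatch e he hlt h)

theorem hubGraph_visCaptureNum (he : Function.Injective e) {l : ℕ} (hl : 0 < l) :
    visCaptureNum (hubGraph e) l = n :=
  le_antisymm (Nat.sInf_le (hubGraph_visCopsCapture e hl))
    (le_csInf ⟨n, hubGraph_visCopsCapture e hl⟩ fun _ h =>
      not_lt.1 fun hlt => hubGraph_not_copsCatch e he hlt h.copsCatch)

end hubGraph

/-- For every integer `k ≥ 2` there is a finite connected simple
graph `G` with `cop'_1(G) ≤ k`, `cop_1(G) = 2k` and classical cop number
`cop(G) = 2k`; consequently `cop_1(G) ≥ 2 ⬝ cop'_1(G)`, and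
`cop_l(G) - cop'_l(G) ≥ k` for every positive integer `l`. -/
theorem construction_doubling_ratio (k : ℕ) (hk : 2 ≤ k) :
    ∃ (V : Type) (_ : Fintype V) (G : SimpleGraph V),
      G.Connected ∧
      visSeeNum G 1 ≤ k ∧
      visCaptureNum G 1 = 2 * k ∧
      copNum G = 2 * k ∧
      2 * visSeeNum G 1 ≤ visCaptureNum G 1 ∧
      ∀ l : ℕ, 0 < l → visSeeNum G l + k ≤ visCaptureNum G l := by
  obtain ⟨p, hp, hprime⟩ := Nat.exists_infinite_primes (2 * k)
  have : Fact p.Prime := ⟨hprime⟩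
  let e : Fin (2 * k) → ZMod p := fun a => (a.1 : ZMod p)
  have he : Function.Injective e := by
    intro a c h
    have := (ZMod.natCast_eq_natCast_iff' a.1 c.1 p).1 h
    rw [Nat.mod_eq_of_lt (by omega), Nat.mod_eq_of_lt (by omega)] at this
    exact Fin.ext this
  have hsee : ∀ l, 0 < l → visSeeNum (hubGraph e) l ≤ k := fun l hl =>
    Nat.sInf_le (hubGraph_visCopsSee e hl)
  refine ⟨_, inferInstance, hubGraph e, hubGraph_connected e (by omega), hsee 1 one_pos,
    hubGraph_visCaptureNum e he one_pos, hubGraph_copNum e he, ?_, fun l hl => ?_⟩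
  · rw [hubGraph_visCaptureNum e he one_pos]
    have := hsee 1 one_pos
    omega
  · rw [hubGraph_visCaptureNum e he hl]
    have := hsee l hl
    omega
end

section
/- For every finite connected simple graph G and every positive integer l, the l-visibility seeing number satisfies cop'_l(G) ≤ ded^1_l(G) + 1. -/
open Classical

/-- The set of vertices not in the closed `l`-neighbourhood of any of the
cleaners at positions `P`. -/
def unseen {V : Type} (G : SimpleGraph V) (l : ℕ) {k : ℕ} (P : Fin k → V) : Set V :=
  {v | ∀ i, ¬ inSight G l (P i) v}

/-- One round of the cleaning process, performed with the cleaners standing at their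
new positions `P`: first every vertex within distance `l` of a cleaner is cleaned,
and then the gas spreads from the remaining gaseous vertices to every adjacent
vertex that is not within distance `l` of a cleaner. -/
def gasStep {V : Type} (G : SimpleGraph V) (l : ℕ) {k : ℕ} (P : Fin k → V)
    (S : Set V) : Set V :=
  (S ∩ unseen G l P) ∪ {v ∈ unseen G l P | ∃ u ∈ S ∩ unseen G l P, G.Adj u v}

/-- A legal sequence of cleaner positions: at each timestep every cleaner stays put
or moves to an adjacent vertex. -/
def ValidMoves {V : Type} (G : SimpleGraph V) {k : ℕ} (pos : ℕ → Fin k → V) : Prop :=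
  ∀ t i, pos (t + 1) i = pos t i ∨ G.Adj (pos t i) (pos (t + 1) i)

/-- The set of gaseous vertices after `t` full rounds (move, clean, spread) of the
cleaning process with `l`-visibility cleaners following the position sequence `pos`.
Initially every vertex not within distance `l` of a cleaner is gaseous. -/
def gasSeq {V : Type} (G : SimpleGraph V) (l : ℕ) {k : ℕ} (pos : ℕ → Fin k → V) :
    ℕ → Set V
  | 0 => unseen G l (pos 0)
  | t + 1 => gasStep G l (pos (t + 1)) (gasSeq G l pos t)

/-- The set of gaseous vertices in round `t + 1` at the intermediate moment after the
cleaners have moved and cleaned, but before the gas spreads. -/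
def gasMid {V : Type} (G : SimpleGraph V) (l : ℕ) {k : ℕ} (pos : ℕ → Fin k → V)
    (t : ℕ) : Set V :=
  gasSeq G l pos t ∩ unseen G l (pos (t + 1))

/-- `k` cleaners with `l`-visibility have a strategy such that at some point during
the cleaning process on `G` at most `r` vertices are gaseous. -/
def CanCleanDownTo {V : Type} (G : SimpleGraph V) (l k r : ℕ) : Prop :=
  ∃ pos : ℕ → Fin k → V, ValidMoves G pos ∧
    ∃ t, (gasSeq G l pos t).ncard ≤ r ∨ (gasMid G l pos t).ncard ≤ r

/-- The `(r, l)`-inference number `ded^r_l(G)`: the minimum number of cleaners with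
`l`-visibility that can reach a state of the cleaning process with at most `r`
gaseous vertices. -/
noncomputable def dedNum {V : Type} (G : SimpleGraph V) (r l : ℕ) : ℕ :=
  sInf {k | CanCleanDownTo G l k r}

/-- `k` cleaners with `l`-visibility have a strategy cleaning `G` of all gas. -/
def CanCleanAll {V : Type} (G : SimpleGraph V) (l k : ℕ) : Prop :=
  ∃ pos : ℕ → Fin k → V, ValidMoves G pos ∧
    ∃ t, gasSeq G l pos t = ∅ ∨ gasMid G l pos t = ∅

/-- The `l`-visibility seeing number `cop'_l(G)`: the minimum number of cleaners with
`l`-visibility that can clean `G` of all gas. -/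
noncomputable def seeNum {V : Type} (G : SimpleGraph V) (l : ℕ) : ℕ :=
  sInf {k | CanCleanAll G l k}

/-- `k` cleaners with `l`-visibility have a strategy such that at some point during
the cleaning process on `G` at least `N` vertices are clean (a vertex being clean
precisely when it is not gaseous). -/
def CanCleanAtLeast {V : Type} (G : SimpleGraph V) (l k N : ℕ) : Prop :=
  ∃ pos : ℕ → Fin k → V, ValidMoves G pos ∧
    ∃ t, N ≤ ((gasSeq G l pos t)ᶜ).ncard ∨ N ≤ ((gasMid G l pos t)ᶜ).ncard

/-- `Δ_l(H)`: the maximum over the vertices `v` of `H` of the number of vertices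
distinct from `v` at distance at most `l` from `v`. -/
noncomputable def maxBall {W : Type} (H : SimpleGraph W) (l : ℕ) : ℕ :=
  ⨆ v : W, {u | u ≠ v ∧ H.Reachable v u ∧ H.dist v u ≤ l}.ncard

theorem unseen_cons_subset {V : Type} (G : SimpleGraph V) (l : ℕ) {k : ℕ} (P : Fin k → V)
    (v : V) : unseen G l (Fin.cons v P : Fin (k + 1) → V) ⊆ unseen G l P \ {v} := by
  intro w hw
  refine ⟨fun i => by simpa using hw i.succ, ?_⟩
  rintro rfl
  exact hw 0 ⟨by simp, by simp⟩

theorem gasStep_mono {V : Type} (G : SimpleGraph V) (l : ℕ) {k m : ℕ} {P : Fin k → V}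
    {Q : Fin m → V} {S T : Set V} (hP : unseen G l P ⊆ unseen G l Q) (hS : S ⊆ T) :
    gasStep G l P S ⊆ gasStep G l Q T := by
  rintro w (⟨h₁, h₂⟩ | ⟨h, u, ⟨h₁, h₂⟩, huw⟩)
  · exact Or.inl ⟨hS h₁, hP h₂⟩
  · exact Or.inr ⟨hP h, u, ⟨hS h₁, hP h₂⟩, huw⟩

theorem gasSeq_subset_unseen {V : Type} (G : SimpleGraph V) (l : ℕ) {k : ℕ}
    (pos : ℕ → Fin k → V) (t : ℕ) : gasSeq G l pos t ⊆ unseen G l (pos t) := by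
  cases t with
  | zero => exact subset_rfl
  | succ t => exact Set.union_subset Set.inter_subset_right (Set.sep_subset _ _)

theorem gasSeq_mono {V : Type} (G : SimpleGraph V) (l : ℕ) {k m : ℕ} {p : ℕ → Fin k → V}
    {q : ℕ → Fin m → V} (h : ∀ t, unseen G l (p t) ⊆ unseen G l (q t)) (t : ℕ) :
    gasSeq G l p t ⊆ gasSeq G l q t := by
  induction t with
  | zero => exact h 0
  | succ t ih => exact gasStep_mono G l (h (t + 1)) ih

/-- Placing a cleaner on every vertex leaves no gas. -/
theorem canCleanDownTo_card {V : Type} [Fintype V] (G : SimpleGraph V) (l r : ℕ) :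
    CanCleanDownTo G l (Fintype.card V) r := by
  refine ⟨fun _ => (Fintype.equivFin V).symm, fun _ _ => Or.inl rfl, 0, Or.inl ?_⟩
  have h : unseen G l (Fintype.equivFin V).symm = ∅ :=
    Set.eq_empty_iff_forall_notMem.2 fun v hv =>
      hv (Fintype.equivFin V v) ⟨by simp, by simp⟩
  simp [gasSeq, h]

/-- An extra cleaner waiting on the last gaseous vertex finishes the cleaning. -/
theorem CanCleanDownTo.canCleanAll_succ {V : Type} [Finite V] [Nonempty V]
    {G : SimpleGraph V} {l k : ℕ} (h : CanCleanDownTo G l k 1) : CanCleanAll G l (k + 1) := by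
  obtain ⟨pos, hpos, t, ht⟩ := h
  have valid (v : V) : ValidMoves G fun s => (Fin.cons v (pos s) : Fin (k + 1) → V) := by
    intro s i
    refine Fin.cases (Or.inl rfl) (fun j => ?_) i
    simpa using hpos s j
  have hseq (v : V) := gasSeq_mono G l
    (fun s => (unseen_cons_subset G l (pos s) v).trans Set.sdiff_subset)
  rcases ht with ht | ht
  · obtain ⟨v, hv⟩ := (Set.ncard_le_one_iff_subset_singleton (Set.toFinite _)).1 ht
    refine ⟨_, valid v, t, Or.inl (Set.eq_empty_iff_forall_notMem.2 fun w hw => ?_)⟩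
    exact (unseen_cons_subset G l _ v (gasSeq_subset_unseen G l _ t hw)).2 (hv (hseq v t hw))
  · obtain ⟨v, hv⟩ := (Set.ncard_le_one_iff_subset_singleton (Set.toFinite _)).1 ht
    refine ⟨_, valid v, t, Or.inr (Set.eq_empty_iff_forall_notMem.2 fun w hw => ?_)⟩
    have hw' := unseen_cons_subset G l _ v hw.2
    exact hw'.2 (hv ⟨hseq v t hw.1, hw'.1⟩)

/-- For every finite connected simple graph `G` and every positive
integer `l`, the `l`-visibility seeing number satisfies `cop'_l(G) ≤ ded^1_l(G) + 1`. -/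
theorem seeNum_le_dedNum_one_add_one {V : Type} [Fintype V] (G : SimpleGraph V)
    (hG : G.Connected) (l : ℕ) (hl : 0 < l) :
    seeNum G l ≤ dedNum G 1 l + 1 := by
  have := hG.nonempty
  have h : CanCleanDownTo G l (dedNum G 1 l) 1 :=
    Nat.sInf_mem (s := {k | CanCleanDownTo G l k 1}) ⟨_, canCleanDownTo_card G l 1⟩
  exact Nat.sInf_le h.canCleanAll_succ
end

section
/- If G is a finite connected simple graph, then two cleaners with 1-visibility have a strategy in the graph cleaning process on G such that at some point either all vertices of G are clean, or at least 8 vertices are clean. -/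
open Classical

/-- The closed neighbourhood of `v` in `G`. -/
def closedNbhd {V : Type} (G : SimpleGraph V) (v : V) : Set V :=
  {u | u = v ∨ G.Adj v u}

theorem inSight_one_iff {V : Type} (G : SimpleGraph V) (c v : V) :
    inSight G 1 c v ↔ v ∈ closedNbhd G c := by
  constructor
  · rintro ⟨hr, hd⟩
    rcases Nat.le_one_iff_eq_zero_or_eq_one.mp hd with h | h
    · exact Or.inl (hr.dist_eq_zero_iff.mp h).symm
    · exact Or.inr (SimpleGraph.dist_eq_one_iff_adj.mp h)
  · rintro (rfl | h)
    · exact ⟨SimpleGraph.Reachable.refl _, by simp⟩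
    · exact ⟨h.reachable, (SimpleGraph.dist_eq_one_iff_adj.mpr h).le⟩

theorem mem_unseen_one_iff {V : Type} (G : SimpleGraph V) (P : Fin 2 → V) (x : V) :
    x ∈ unseen G 1 P ↔ x ∉ closedNbhd G (P 0) ∧ x ∉ closedNbhd G (P 1) := by
  simp [unseen, Fin.forall_fin_two, inSight_one_iff]

/-- In a single move, two cleaners clean the union of the four closed neighbourhoods
of their initial and final positions. -/
theorem exists_move_gasMid_subset {V : Type} (G : SimpleGraph V) {a a' b b' : V}
    (ha : a' ∈ closedNbhd G a) (hb : b' ∈ closedNbhd G b) :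
    ∃ pos : ℕ → Fin 2 → V, ValidMoves G pos ∧
      closedNbhd G a ∪ closedNbhd G a' ∪ closedNbhd G b ∪ closedNbhd G b' ⊆
        (gasMid G 1 pos 0)ᶜ := by
  refine ⟨fun t => if t = 0 then ![a, b] else ![a', b'], ?_, ?_⟩
  · intro t i
    cases t with
    | zero => fin_cases i <;> simpa [closedNbhd]
    | succ t => simp
  · intro x hx hg
    have h0 := (mem_unseen_one_iff G _ x).mp hg.1
    have h1 := (mem_unseen_one_iff G _ x).mp hg.2
    simp at h0 h1 hx
    tauto

theorem canCleanAtLeast_of_move {V : Type} [Fintype V] (G : SimpleGraph V)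
    {a a' b b' : V} {N : ℕ} {S : Set V}
    (ha : a' ∈ closedNbhd G a) (hb : b' ∈ closedNbhd G b)
    (hS : S ⊆ closedNbhd G a ∪ closedNbhd G a' ∪ closedNbhd G b ∪ closedNbhd G b')
    (hN : N ≤ S.ncard) : CanCleanAtLeast G 1 2 N := by
  obtain ⟨pos, hv, hsub⟩ := exists_move_gasMid_subset G ha hb
  exact ⟨pos, hv, 0, Or.inr (hN.trans (Set.ncard_le_ncard (hS.trans hsub)))⟩

theorem canCleanAll_of_move {V : Type} (G : SimpleGraph V) {a a' b b' : V}
    (ha : a' ∈ closedNbhd G a) (hb : b' ∈ closedNbhd G b)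
    (hS : ∀ x, x ∈ closedNbhd G a ∪ closedNbhd G a' ∪ closedNbhd G b ∪ closedNbhd G b') :
    CanCleanAll G 1 2 := by
  obtain ⟨pos, hv, hsub⟩ := exists_move_gasMid_subset G ha hb
  exact ⟨pos, hv, 0, Or.inr (Set.eq_empty_of_forall_notMem fun x hx => hsub (hS x) hx)⟩

theorem getVert_succ_mem_closedNbhd {V : Type} {G : SimpleGraph V} {u v : V}
    (p : G.Walk u v) (t : ℕ) : p.getVert (t + 1) ∈ closedNbhd G (p.getVert t) := by
  rcases lt_or_ge t p.length with h | h
  · exact Or.inr (p.adj_getVert_succ h)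
  · left
    rw [p.getVert_of_length_le h, p.getVert_of_length_le (by omega)]

theorem getVert_mem_closedNbhd_succ {V : Type} {G : SimpleGraph V} {u v : V}
    (p : G.Walk u v) (t : ℕ) : p.getVert t ∈ closedNbhd G (p.getVert (t + 1)) := by
  rcases getVert_succ_mem_closedNbhd p t with h | h
  · exact Or.inl h.symm
  · exact Or.inr h.symm

theorem exists_walk_subset_support {V : Type} {G : SimpleGraph V} (hG : G.Connected)
    (s : Finset V) (u : V) : ∃ (w : V) (p : G.Walk u w), ∀ x ∈ s, x ∈ p.support := by
  induction s using Finset.induction_on with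
  | empty => exact ⟨u, .nil, by simp⟩
  | insert a s _ ih =>
    obtain ⟨w, p, hp⟩ := ih
    obtain ⟨q⟩ := hG.preconnected w a
    refine ⟨a, p.append q, fun x hx => ?_⟩
    rw [SimpleGraph.Walk.mem_support_append_iff]
    rcases Finset.mem_insert.mp hx with rfl | hx
    · exact Or.inr q.end_mem_support
    · exact Or.inl (hp x hx)

/-- If, outside the closed neighbourhood of `v`, every vertex lies in a union of components
dominated by a single vertex, then one cleaner guarding `v` and one touring `G` clean `G`. -/
theorem canCleanAll_of_dominated {V : Type} [Fintype V] {G : SimpleGraph V}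
    (hG : G.Connected) (v : V)
    (h : ∀ x ∉ closedNbhd G v, ∃ (c : V) (C : Set V), x ∈ C ∧ C ⊆ closedNbhd G c ∧
      ∀ y ∈ C, ∀ z, G.Adj y z → z ∈ C ∪ closedNbhd G v) :
    CanCleanAll G 1 2 := by
  obtain ⟨w, p, hp⟩ := exists_walk_subset_support hG Finset.univ v
  refine ⟨fun t => ![v, p.getVert t], ?_, p.length, Or.inl ?_⟩
  · intro t i
    fin_cases i
    · simp
    · simpa [closedNbhd] using getVert_succ_mem_closedNbhd p t
  · refine Set.eq_empty_of_forall_notMem fun x hx => ?_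
    have hxv := ((mem_unseen_one_iff G _ x).mp (gasSeq_subset_unseen _ _ _ _ hx)).1
    obtain ⟨c, C, hxC, hCc, hC⟩ := h x hxv
    obtain ⟨t, rfl, ht⟩ := SimpleGraph.Walk.mem_support_iff_exists_getVert.mp
      (hp c (Finset.mem_univ c))
    refine Nat.le_induction (P := fun s _ => ∀ y ∈ C,
      y ∉ gasSeq G 1 (fun t => ![v, p.getVert t]) s) ?_ ?_ p.length ht x hxC hx
    · intro y hy hg
      exact ((mem_unseen_one_iff G _ y).mp (gasSeq_subset_unseen _ _ _ _ hg)).2 (hCc hy)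
    · rintro s _ ih y hy (hg | ⟨-, u, hu, huy⟩)
      · exact ih y hy hg.1
      · rcases hC y hy u huy.symm with h' | h'
        · exact ih u h' hu.1
        · exact ((mem_unseen_one_iff G _ u).mp hu.2).1 h'

theorem clean_of_three_le_degree {V : Type} [Fintype V] {G : SimpleGraph V}
    (hG : G.Connected) (v : V) (hv : 4 ≤ (closedNbhd G v).ncard) :
    CanCleanAll G 1 2 ∨ CanCleanAtLeast G 1 2 8 := by
  by_cases h : ∃ u u', u' ∈ closedNbhd G u ∧
      4 ≤ ((closedNbhd G u ∪ closedNbhd G u') \ closedNbhd G v).ncard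
  · right
    obtain ⟨u, u', hu, h4⟩ := h
    refine canCleanAtLeast_of_move G (a := v) (a' := v) (Or.inl rfl) hu
      (S := closedNbhd G v ∪ ((closedNbhd G u ∪ closedNbhd G u') \ closedNbhd G v)) ?_ ?_
    · intro x hx
      simp only [Set.mem_union, Set.mem_sdiff] at hx ⊢
      tauto
    · rw [Set.ncard_union_eq Set.disjoint_sdiff_right]
      omega
  · left
    push Not at h
    refine canCleanAll_of_dominated hG v fun x hx => ?_
    have closed : ∀ c, 3 ≤ (closedNbhd G c \ closedNbhd G v).ncard →
        ∀ y ∈ closedNbhd G c \ closedNbhd G v, ∀ z, G.Adj y z →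
          z ∈ (closedNbhd G c \ closedNbhd G v) ∪ closedNbhd G v := by
      intro c hc y hy z hyz
      by_contra hz
      simp only [Set.mem_union, Set.mem_sdiff, not_or, not_and, not_not] at hz
      refine absurd (h c y hy.1) (not_lt.mpr ?_)
      have hzT : z ∉ closedNbhd G c \ closedNbhd G v := fun h' => h'.2 (hz.1 h'.1)
      have h1 := Set.ncard_insert_of_notMem hzT
      have h2 : insert z (closedNbhd G c \ closedNbhd G v) ⊆
          (closedNbhd G c ∪ closedNbhd G y) \ closedNbhd G v := by
        rintro w (rfl | hw)
        · exact ⟨Or.inr (Or.inr hyz), hz.2⟩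
        · exact ⟨Or.inl hw.1, hw.2⟩
      have := Set.ncard_le_ncard h2
      omega
    by_cases hc : ∃ c, x ∈ closedNbhd G c ∧ 3 ≤ (closedNbhd G c \ closedNbhd G v).ncard
    · obtain ⟨c, hxc, hc⟩ := hc
      exact ⟨c, closedNbhd G c \ closedNbhd G v, ⟨hxc, hx⟩, Set.sdiff_subset, closed c hc⟩
    · push Not at hc
      refine ⟨x, closedNbhd G x \ closedNbhd G v, ⟨Or.inl rfl, hx⟩, Set.sdiff_subset, ?_⟩
      rintro y ⟨hy, hyv⟩ z hyz
      by_contra hz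
      simp only [Set.mem_union, Set.mem_sdiff, not_or, not_and, not_not] at hz
      rcases hy with rfl | hy
      · exact hz.2 (hz.1 (Or.inr hyz))
      · refine absurd (hc y (Or.inr hy.symm)) (not_lt.mpr ?_)
        have hxz : x ≠ z := fun e => hz.2 (hz.1 (Or.inl e.symm))
        have h3 : ({x, y, z} : Set V).ncard = 3 :=
          Set.ncard_eq_three.mpr ⟨x, y, z, hy.ne, hxz, hyz.ne, rfl⟩
        rw [← h3]
        refine Set.ncard_le_ncard ?_
        rintro w (rfl | rfl | rfl)
        · exact ⟨Or.inr hy.symm, hx⟩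
        · exact ⟨Or.inl rfl, hyv⟩
        · exact ⟨Or.inr hyz, hz.2⟩

theorem mem_support_of_longest {V : Type} [Fintype V] {G : SimpleGraph V}
    (hG : G.Connected) (hd : ∀ v, (closedNbhd G v).ncard ≤ 3) {u v : V} (p : G.Walk u v)
    (hp : p.IsPath)
    (hmax : ∀ (u' v' : V) (q : G.Walk u' v'), q.IsPath → q.length ≤ p.length) (x : V) :
    x ∈ p.support := by
  have start : ∀ {a b : V} (q : G.Walk a b), q.IsPath → q.length = p.length →
      ∀ z, G.Adj a z → z ∈ q.support := by
    intro a b q hq hl z hz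
    by_contra hzq
    have := hmax _ _ (.cons hz.symm q) (hq.cons hzq)
    simp at this
    omega
  have closed : ∀ y ∈ p.support, ∀ z, G.Adj y z → z ∈ p.support := by
    intro y hy z hyz
    obtain ⟨n, rfl, hn⟩ := SimpleGraph.Walk.mem_support_iff_exists_getVert.mp hy
    rcases Nat.eq_zero_or_pos n with rfl | hpos
    · rw [p.getVert_zero] at hyz
      exact start p hp rfl z hyz
    rcases hn.eq_or_lt with rfl | hlt
    · rw [p.getVert_length] at hyz
      simpa using start p.reverse hp.reverse (by simp) z hyz
    by_contra hz
    obtain ⟨m, rfl⟩ := Nat.exists_eq_succ_of_ne_zero hpos.ne'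
    have h1 := p.adj_getVert_succ (i := m) (by omega)
    have h2 := p.adj_getVert_succ hlt
    have h3 : p.getVert m ≠ p.getVert (m + 1 + 1) := fun e => by
      have := hp.getVert_injOn (by simp; omega) (by simp; omega) e
      omega
    have h4 : ({p.getVert m, p.getVert (m + 1), p.getVert (m + 1 + 1)} : Set V).ncard = 3 :=
      Set.ncard_eq_three.mpr ⟨_, _, _, h1.ne, h3, h2.ne, rfl⟩
    have h5 : z ∉ ({p.getVert m, p.getVert (m + 1), p.getVert (m + 1 + 1)} : Set V) := by
      rintro (rfl | rfl | rfl) <;> exact hz (p.getVert_mem_support _)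
    have h6 := Set.ncard_insert_of_notMem h5
    have h7 : insert z ({p.getVert m, p.getVert (m + 1), p.getVert (m + 1 + 1)} : Set V) ⊆
        closedNbhd G (p.getVert (m + 1)) := by
      rintro w (rfl | rfl | rfl | rfl)
      exacts [Or.inr hyz, Or.inr h1.symm, Or.inl rfl, Or.inr h2]
    have := Set.ncard_le_ncard h7
    have := hd (p.getVert (m + 1))
    omega
  obtain ⟨w⟩ := hG.preconnected u x
  have reach : ∀ {a b : V}, G.Walk a b → a ∈ p.support → b ∈ p.support := by
    intro a b w
    induction w with
    | nil => exact id
    | cons h _ ih => exact fun ha => ih (closed _ ha _ h)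
  exact reach w p.start_mem_support

theorem exists_longest_path {V : Type} [Fintype V] (G : SimpleGraph V) [Nonempty V] :
    ∃ (u v : V) (p : G.Walk u v), p.IsPath ∧
      ∀ (u' v' : V) (q : G.Walk u' v'), q.IsPath → q.length ≤ p.length := by
  let S : Set ℕ := {n | ∃ (u v : V) (p : G.Walk u v), p.IsPath ∧ p.length = n}
  have hbdd : BddAbove S := ⟨Fintype.card V, by
    rintro n ⟨u, v, p, hp, rfl⟩
    exact hp.length_lt.le⟩
  have hne : S.Nonempty :=
    ⟨0, Classical.arbitrary V, Classical.arbitrary V, .nil, .nil, rfl⟩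
  obtain ⟨u, v, p, hp, hl⟩ := Nat.sSup_mem hne hbdd
  exact ⟨u, v, p, hp, fun u' v' q hq => hl ▸ le_csSup hbdd ⟨u', v', q, hq, rfl⟩⟩

theorem clean_of_degree_le_two {V : Type} [Fintype V] {G : SimpleGraph V}
    (hG : G.Connected) (hd : ∀ v, (closedNbhd G v).ncard ≤ 3) :
    CanCleanAll G 1 2 ∨ CanCleanAtLeast G 1 2 8 := by
  have := hG.nonempty
  obtain ⟨u, v, p, hp, hmax⟩ := exists_longest_path G
  have cover : ∀ i < 8, p.getVert i ∈
      closedNbhd G (p.getVert 1) ∪ closedNbhd G (p.getVert 2) ∪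
      closedNbhd G (p.getVert 5) ∪ closedNbhd G (p.getVert 6) := by
    intro i hi
    have hs := getVert_succ_mem_closedNbhd p
    have hb := getVert_mem_closedNbhd_succ p
    have h0 := hb 0
    have h1 := hb 1
    have h3 := hs 2
    have h4 := hb 4
    have h5 := hb 5
    have h2 := hs 1
    have h6 := hs 5
    have h7 := hs 6
    interval_cases i <;> simp_all
  have ha := getVert_succ_mem_closedNbhd p 1
  have hb := getVert_succ_mem_closedNbhd p 5
  rcases lt_or_ge p.length 7 with hl | hl
  · refine Or.inl (canCleanAll_of_move G ha hb fun x => ?_)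
    obtain ⟨n, rfl, hn⟩ := SimpleGraph.Walk.mem_support_iff_exists_getVert.mp
      (mem_support_of_longest hG hd p hp hmax x)
    exact cover n (by omega)
  · refine Or.inr (canCleanAtLeast_of_move G ha hb (S := p.getVert '' Set.Iio 8) ?_ ?_)
    · rintro _ ⟨i, hi, rfl⟩
      exact cover i hi
    · rw [Set.InjOn.ncard_image]
      · simp [Set.ncard_eq_toFinset_card']
      · exact hp.getVert_injOn.mono fun i hi => by
          simp at hi ⊢
          omega

/-- If `G` is a finite connected simple graph, then two cleaners
with `1`-visibility have a strategy in the graph cleaning process on `G` such that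
at some point either all vertices of `G` are clean, or at least `8` vertices are
clean. -/
theorem two_cleaners_clean_eight {V : Type} [Fintype V] (G : SimpleGraph V)
    (hG : G.Connected) :
    CanCleanAll G 1 2 ∨ CanCleanAtLeast G 1 2 8 := by
  by_cases h : ∃ v, 4 ≤ (closedNbhd G v).ncard
  · obtain ⟨v, hv⟩ := h
    exact clean_of_three_le_degree hG v hv
  · push Not at h
    exact clean_of_degree_le_two hG fun v => Nat.le_of_lt_succ (h v)
end
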